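/- The canonical map O_K̄ ⊗_{O_K} Ω¹_{O_K/O_{K₀}} → Ω¹_{O_K̄/O_{K₀}} is injective with cokernel Ω¹_{O_K̄/O_K}, and O_K̄ ⊗_{O_K} Ω¹_{O_K/O_{K₀}} is isomorphic to O_K̄/D_{K/K₀}O_K̄; hence there is a short exact sequence 0 → O_K̄/D_{K/K₀}O_K̄ → Ω¹_{O_K̄/O_{K₀}} → Ω¹_{O_K̄/O_K} → 0. Moreover the natural map Ω¹_{O_K̄/ℤ_p} → Ω¹_{O_K̄/O_{K₀}} is an isomorphism. -/

import Mathlib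

open TensorProduct

open Polynomial in
/-- If finitely many generators of a domain `S` over `R` always lie in `R[x]` for a single
generator `x` whose relations are multiples of a polynomial separable at `x`, then the first
homology of the naive cotangent complex of `S` over `R` vanishes. -/
theorem Algebra.Generators.subsingleton_h1Cotangent_of_adjoin_singleton {R S ι : Type*}
    [CommRing R] [CommRing S] [IsDomain S] [Algebra R S] (P : Algebra.Generators R S ι)
    (H : ∀ s : Finset ι, ∃ (i : ι) (f : R[X]), (∀ j ∈ s, P.val j ∈ Algebra.adjoin R {P.val i}) ∧
      aeval (P.val i) f = 0 ∧ aeval (P.val i) (derivative f) ≠ 0 ∧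
      ∀ q : R[X], aeval (P.val i) q = 0 → f ∣ q) :
    Subsingleton P.toExtension.H1Cotangent := by
  classical
  refine subsingleton_of_forall_eq 0 fun z ↦ ?_
  obtain ⟨⟨x, hx⟩, hxz⟩ := Algebra.Extension.Cotangent.mk_surjective
    (Algebra.Extension.h1Cotangentι z)
  change MvPolynomial ι R at x
  obtain ⟨i, f, hs, hf, hf', hdvd⟩ := H (MvPolynomial.vars x)
  have hex (j : ι) (h : P.val j ∈ Algebra.adjoin R {P.val i}) :
      ∃ g : R[X], aeval (P.val i) g = P.val j := by
    rwa [Algebra.adjoin_singleton_eq_range_aeval] at h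
  choose g hg using hex
  have haeval (q : R[X]) : MvPolynomial.aeval P.val
      (aeval (MvPolynomial.X i : MvPolynomial ι R) q) = aeval (P.val i) q := by
    rw [← Polynomial.aeval_algHom_apply, MvPolynomial.aeval_X]
  have hmem (q : R[X]) (hq : aeval (P.val i) q = 0) :
      aeval (MvPolynomial.X i : MvPolynomial ι R) q ∈ P.ker := by
    rw [← haeval] at hq
    rwa [P.ker_eq_ker_aeval_val]
  -- replace every variable that occurs in `x` by a polynomial in the variable `X i`
  let φ : P.Hom P :=
    { val := fun j ↦ if h : P.val j ∈ Algebra.adjoin R {P.val i} then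
          aeval (MvPolynomial.X i : MvPolynomial ι R) (g j h)
        else MvPolynomial.X j
      aeval_val := fun j ↦ by
        split_ifs with h
        · rw [haeval, hg]; rfl
        · simp }
  obtain ⟨q, hq⟩ : ∃ q : R[X], φ.toAlgHom x = aeval (MvPolynomial.X i : MvPolynomial ι R) q := by
    let ψ : ι → R[X] := fun j ↦ if h : P.val j ∈ Algebra.adjoin R {P.val i} then g j h else 0
    refine ⟨MvPolynomial.aeval ψ x, ?_⟩
    rw [← AlgHom.comp_apply, MvPolynomial.comp_aeval]
    refine MvPolynomial.eval₂Hom_congr' rfl (fun j hj _ ↦ ?_) rfl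
    have := hs j hj
    simp [φ, ψ, this]
  have hz : Algebra.Extension.H1Cotangent.map φ.toExtensionHom z = z := by
    rw [Algebra.Extension.H1Cotangent.map_eq _ (.id P.toExtension)]
    simp
  have hq0 : aeval (P.val i) q = 0 := by
    rw [← haeval, ← hq]
    have hx' : x ∈ P.ker := hx
    rw [P.ker_eq_ker_aeval_val, RingHom.mem_ker] at hx'
    simp [hx']
  have hz' : Algebra.Extension.h1Cotangentι z =
      Algebra.Extension.Cotangent.mk (P := P.toExtension)
        ⟨aeval (MvPolynomial.X i : MvPolynomial ι R) q, hmem q hq0⟩ := by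
    rw [← hz]
    refine (congr_arg (Algebra.Extension.Cotangent.map φ.toExtensionHom) hxz.symm).trans ?_
    rw [Algebra.Extension.Cotangent.map_mk]
    congr 2
  have hq1 : aeval (P.val i) (derivative q) = 0 := by
    have h0 : P.toExtension.cotangentComplex (Algebra.Extension.h1Cotangentι z) = 0 := z.2
    rw [hz', Algebra.Extension.cotangentComplex_mk] at h0
    have h1 := congr(P.cotangentSpaceBasis.repr $h0 i)
    rw [P.cotangentSpaceBasis_repr_one_tmul] at h1
    simp only [map_zero, Finsupp.coe_zero, Pi.zero_apply] at h1
    rw [← haeval, ← h1]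
    congr 1
    rw [Derivation.map_aeval]
    simp
  obtain ⟨r, rfl⟩ := hdvd q hq0
  have hr : aeval (P.val i) r = 0 := by
    simpa [hf, hf'] using hq1
  obtain ⟨r, rfl⟩ := hdvd r hr
  apply Algebra.Extension.h1Cotangentι_injective
  rw [hz', map_zero]
  refine (Algebra.Extension.Cotangent.mk_eq_zero_iff _).2 ?_
  change aeval (MvPolynomial.X i : MvPolynomial ι R) (f * (f * r)) ∈ P.ker ^ 2
  rw [map_mul, map_mul, ← mul_assoc, ← sq]
  exact Ideal.mul_mem_right _ _ (Ideal.pow_mem_pow (hmem f hf) 2)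

open Polynomial in
/-- The Kähler differentials of `B = A[x] = A[X] / (f)` are the quotient of `B` by the derivative of
`f` evaluated at `x`. -/
theorem KaehlerDifferential.nonempty_equiv_quotient_of_adjoin_eq_top {A B : Type*} [CommRing A]
    [CommRing B] [Algebra A B] {x : B} (hx : Algebra.adjoin A {x} = ⊤) {f : A[X]}
    (hf : aeval x f = 0) (hdvd : ∀ q : A[X], aeval x q = 0 → f ∣ q) :
    Nonempty (Ω[B⁄A] ≃ₗ[B] B ⧸ Ideal.span {aeval x (derivative f)}) := by
  have hsurj : Function.Surjective (aeval x : A[X] →ₐ[A] B) := by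
    rwa [Algebra.adjoin_singleton_eq_range_aeval, AlgHom.range_eq_top] at hx
  choose s hs using hsurj
  set J := Ideal.span {aeval x (derivative f)}
  have key (b : B) (q : A[X]) (hq : aeval x q = b) :
      Ideal.Quotient.mk J (aeval x (derivative (s b))) =
        Ideal.Quotient.mk J (aeval x (derivative q)) := by
    obtain ⟨r, hr⟩ := hdvd (s b - q) (by rw [map_sub, hs, hq, sub_self])
    have h1 : aeval x (derivative (s b)) - aeval x (derivative q) =
        aeval x (derivative f) * aeval x r := by
      rw [← map_sub, ← derivative_sub, hr, derivative_mul, map_add, map_mul, map_mul, hf]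
      ring
    rw [Ideal.Quotient.eq, h1]
    exact Ideal.mul_mem_right _ _ (Ideal.mem_span_singleton_self _)
  let d : Derivation A B (B ⧸ J) := Derivation.mk'
    { toFun := fun b ↦ Ideal.Quotient.mk J (aeval x (derivative (s b)))
      map_add' := fun a b ↦ by
        rw [key (a + b) (s a + s b) (by simp [hs])]
        simp
      map_smul' := fun r b ↦ by
        rw [key (r • b) (r • s b) (by simp [hs]), derivative_smul, map_smul]
        rfl } fun a b ↦ by
      change Ideal.Quotient.mk J _ = a • Ideal.Quotient.mk J _ + b • Ideal.Quotient.mk J _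
      rw [key (a * b) (s a * s b) (by simp [hs])]
      simp only [derivative_mul, map_add, map_mul, hs, Algebra.smul_def,
        Ideal.Quotient.algebraMap_eq]
      ring
  have hdx : d x = Ideal.Quotient.mk J 1 := by
    refine (key x X (by simp)).trans ?_
    simp
  let ψ : (B ⧸ J) →ₗ[B] Ω[B⁄A] :=
    Submodule.liftQ J (LinearMap.toSpanSingleton B _ (KaehlerDifferential.D A B x)) <| by
      rw [Submodule.span_le, Set.singleton_subset_iff]
      simp only [SetLike.mem_coe, LinearMap.mem_ker, LinearMap.toSpanSingleton_apply]
      rw [← Derivation.map_aeval, hf, map_zero]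
  have hψ : ψ (Ideal.Quotient.mk J 1) = KaehlerDifferential.D A B x := by
    refine (Submodule.liftQ_apply _ _ _).trans ?_
    simp
  refine ⟨LinearEquiv.ofLinearMap d.liftKaehlerDifferential ψ ?_ ?_⟩
  · refine Submodule.linearMap_qext _ (LinearMap.ext_ring ?_)
    change d.liftKaehlerDifferential (ψ (Ideal.Quotient.mk J 1)) = Ideal.Quotient.mk J 1
    rw [hψ, Derivation.liftKaehlerDifferential_comp_D, hdx]
  · refine Derivation.liftKaehlerDifferential_unique _ _ (Derivation.ext_of_adjoin_eq_top {x} hx ?_)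
    rintro _ rfl
    change ψ (d.liftKaehlerDifferential (KaehlerDifferential.D A B _)) = KaehlerDifferential.D A B _
    rw [Derivation.liftKaehlerDifferential_comp_D, hdx, hψ]

open Polynomial IsLocalRing in
/-- A finite local extension of a local ring by a discrete valuation ring, with separable residue
field extension, is generated by one element. -/
theorem IsLocalRing.exists_adjoin_singleton_eq_top_of_isDiscreteValuationRing (R S : Type*)
    [CommRing R] [IsLocalRing R] [CommRing S] [IsDomain S] [IsDiscreteValuationRing S] [Algebra R S]
    [Module.Finite R S] [IsLocalHom (algebraMap R S)]
    [Algebra.IsSeparable (ResidueField R) (ResidueField S)]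
    (hR : (maximalIdeal R).map (algebraMap R S) ≠ ⊥) :
    ∃ x : S, Algebra.adjoin R {x} = ⊤ := by
  obtain ⟨ϖ, hϖ⟩ := IsDiscreteValuationRing.exists_irreducible S
  have hmax : maximalIdeal S = Ideal.span {ϖ} := hϖ.maximalIdeal_eq
  obtain ⟨n, hn⟩ := IsDiscreteValuationRing.ideal_eq_span_pow_irreducible hR hϖ
  have hmapres (a : S) (q : R[X]) :
      residue S (aeval a q) = aeval (residue S a) (q.map (residue R)) :=
    map_aeval_eq_aeval_map (ψ := residue S) (φ := residue R) rfl q a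
  -- a generator of the residue field extension, and a lift of its minimal polynomial
  obtain ⟨a₀, ha₀⟩ := Field.exists_primitive_element (ResidueField R) (ResidueField S)
  have ha₀' : Algebra.adjoin (ResidueField R) {a₀} = ⊤ := by
    rw [← IntermediateField.adjoin_simple_toSubalgebra_of_isAlgebraic (IsAlgebraic.of_finite _ _),
      ha₀, IntermediateField.top_toSubalgebra]
  obtain ⟨f, hf⟩ := Polynomial.map_surjective _ residue_surjective (minpoly (ResidueField R) a₀)
  -- a lift of the generator at which that polynomial takes a uniformizing value
  obtain ⟨a, ha, hfa⟩ : ∃ a : S, residue S a = a₀ ∧ ∃ u : S, IsUnit u ∧ aeval a f = ϖ * u := by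
    obtain ⟨a, ha⟩ := residue_surjective (R := S) a₀
    have h0 : aeval a f ∈ maximalIdeal S := by
      rw [← residue_eq_zero_iff, hmapres, hf, ha, minpoly.aeval]
    rw [hmax, Ideal.mem_span_singleton] at h0
    obtain ⟨t, ht⟩ := h0
    by_cases htu : IsUnit t
    · exact ⟨a, ha, t, htu, ht⟩
    have hϖres : residue S ϖ = 0 := by
      rw [residue_eq_zero_iff, hmax]; exact Ideal.mem_span_singleton_self _
    have htres : residue S t = 0 := by
      rw [residue_eq_zero_iff]; exact htu
    obtain ⟨c, hc⟩ := (f.map (algebraMap R S)).exists_mul_sq_add_linear_part_eq_eval_add a ϖ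
    refine ⟨a + ϖ, by simp [ha, hϖres], t + aeval a (derivative f) + c * ϖ, ?_, ?_⟩
    · rw [← residue_ne_zero_iff_isUnit]
      simp only [map_add, map_mul, htres, hϖres, hmapres, ha, ← derivative_map, hf, zero_add,
        mul_zero, add_zero]
      exact (Algebra.IsSeparable.isSeparable _ _).aeval_derivative_ne_zero (minpoly.aeval _ _)
    · rw [derivative_map, eval_map_algebraMap, eval_map_algebraMap, eval_map_algebraMap, ht] at hc
      rw [← hc]; ring
  obtain ⟨u, hu, hfa⟩ := hfa
  refine ⟨a, ?_⟩
  set T := Algebra.adjoin R {a} with hT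
  have haT (q : R[X]) : aeval a q ∈ T := by
    rw [hT, Algebra.adjoin_singleton_eq_range_aeval]; exact ⟨q, rfl⟩
  have hstep (s : S) : ∃ t ∈ T, ∃ r, s = t + aeval a f * r := by
    obtain ⟨p, hp⟩ : ∃ p, aeval a₀ p = residue S s := by
      rw [Algebra.adjoin_singleton_eq_range_aeval, AlgHom.range_eq_top] at ha₀'
      exact ha₀' _
    obtain ⟨q, rfl⟩ := Polynomial.map_surjective _ residue_surjective p
    have h0 : s - aeval a q ∈ maximalIdeal S := by
      rw [← residue_eq_zero_iff, map_sub, hmapres, ha, hp, sub_self]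
    rw [hmax, Ideal.mem_span_singleton] at h0
    obtain ⟨r, hr⟩ := h0
    obtain ⟨u, rfl⟩ := hu
    refine ⟨_, haT q, ↑u⁻¹ * r, ?_⟩
    rw [hfa, mul_assoc, Units.mul_inv_cancel_left, ← hr]; ring
  have hpow (m : ℕ) (s : S) : ∃ t ∈ T, ∃ r, s = t + aeval a f ^ m * r := by
    induction m with
    | zero => exact ⟨0, T.zero_mem, s, by simp⟩
    | succ m ih =>
      obtain ⟨t, ht, r, rfl⟩ := ih
      obtain ⟨t', ht', r', rfl⟩ := hstep r
      exact ⟨t + aeval a f ^ m * t', T.add_mem ht (T.mul_mem (T.pow_mem (haT f) m) ht'), r', by ring⟩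
  refine eq_top_iff.mpr <| Submodule.le_of_le_smul_of_le_jacobson_bot
    (Module.finite_def.mp inferInstance) (IsLocalRing.maximalIdeal_le_jacobson ⊥)
    (?_ : ⊤ ≤ (Algebra.adjoin R {a}).toSubmodule ⊔ maximalIdeal R • ⊤)
  intro s _
  obtain ⟨t, ht, r, rfl⟩ := hpow n s
  refine Submodule.add_mem_sup ht ?_
  rw [Ideal.smul_top_eq_map, Submodule.restrictScalars_mem, hn, hfa, mul_pow, mul_assoc]
  exact Ideal.mul_mem_right _ _ (Ideal.mem_span_singleton_self _)

/-- The integral closure of `ℤ_[p]` in an algebraic extension of `ℚ_[p]` is a valuation ring. -/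
theorem PadicInt.isIntegral_or_isIntegral_inv (p : ℕ) [Fact p.Prime] {L : Type*} [Field L]
    [Algebra ℚ_[p] L] [Algebra.IsAlgebraic ℚ_[p] L] [Algebra ℤ_[p] L]
    [IsScalarTower ℤ_[p] ℚ_[p] L] (x : L) : IsIntegral ℤ_[p] x ∨ IsIntegral ℤ_[p] x⁻¹ := by
  have key (y : L) (hy : spectralNorm ℚ_[p] L y ≤ 1) : IsIntegral ℤ_[p] y := by
    have hmonic : (minpoly ℚ_[p] y).Monic := minpoly.monic (Algebra.IsIntegral.isIntegral y)
    have hcoeff := (spectralValue_le_one_iff hmonic).1 hy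
    have hlift : minpoly ℚ_[p] y ∈ Polynomial.lifts (algebraMap ℤ_[p] ℚ_[p]) :=
      (Polynomial.lifts_iff_coeff_lifts _).2 fun n ↦ ⟨⟨_, hcoeff n⟩, rfl⟩
    obtain ⟨q, hq, -, hq'⟩ := Polynomial.lifts_and_natDegree_eq_and_monic hlift hmonic
    refine ⟨q, hq', ?_⟩
    rw [← Polynomial.aeval_def, ← Polynomial.aeval_map_algebraMap ℚ_[p], hq, minpoly.aeval]
  rcases le_total (spectralNorm ℚ_[p] L x) 1 with h | h
  · exact .inl (key x h)
  · refine .inr (key _ ?_)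
    rw [← spectralMulAlgNorm_def] at h ⊢
    have hx : x ≠ 0 := by
      rintro rfl
      rw [map_zero] at h
      exact absurd h (by norm_num)
    have h1 : spectralMulAlgNorm ℚ_[p] L x * spectralMulAlgNorm ℚ_[p] L x⁻¹ = 1 := by
      rw [← map_mul, mul_inv_cancel₀ hx, map_one]
    nlinarith [apply_nonneg (spectralMulAlgNorm ℚ_[p] L) x⁻¹]

theorem PadicInt.faithfulSMul_of_isScalarTower (p : ℕ) [Fact p.Prime] (L O : Type*) [Field L]
    [Algebra ℚ_[p] L] [Algebra ℤ_[p] L] [IsScalarTower ℤ_[p] ℚ_[p] L] [CommRing O]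
    [Algebra ℤ_[p] O] [Algebra O L] [IsScalarTower ℤ_[p] O L] : FaithfulSMul ℤ_[p] O := by
  rw [faithfulSMul_iff_algebraMap_injective]
  refine .of_comp (f := algebraMap O L) ?_
  rw [← RingHom.coe_comp, ← IsScalarTower.algebraMap_eq,
    IsScalarTower.algebraMap_eq ℤ_[p] ℚ_[p] L]
  exact (algebraMap ℚ_[p] L).injective.comp (IsFractionRing.injective ℤ_[p] ℚ_[p])

theorem PadicInt.finite_residueField (p : ℕ) [Fact p.Prime] (O : Type*) [CommRing O]
    [IsLocalRing O] [Algebra ℤ_[p] O] [FaithfulSMul ℤ_[p] O] [Module.Finite ℤ_[p] O] :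
    Finite (IsLocalRing.ResidueField O) :=
  IsLocalRing.ResidueField.finite_of_finite (R := ℤ_[p])
    (.of_equiv _ (PadicInt.residueField (p := p)).symm.toEquiv)

theorem PadicInt.isDiscreteValuationRing_of_isIntegralClosure (p : ℕ) [Fact p.Prime]
    (L : Type*) [Field L] [Algebra ℚ_[p] L] [FiniteDimensional ℚ_[p] L] [Algebra ℤ_[p] L]
    [IsScalarTower ℤ_[p] ℚ_[p] L] (O : Type*) [CommRing O] [IsDomain O] [Algebra ℤ_[p] O]
    [Algebra O L] [IsScalarTower ℤ_[p] O L] [IsIntegralClosure O ℤ_[p] L] :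
    IsDiscreteValuationRing O := by
  have := IsIntegralClosure.isFractionRing_of_finite_extension ℤ_[p] ℚ_[p] L O
  have := IsIntegralClosure.isDedekindDomain ℤ_[p] ℚ_[p] L O
  have : ValuationRing O := by
    rw [ValuationRing.iff_isInteger_or_isInteger O L]
    intro x
    exact (PadicInt.isIntegral_or_isIntegral_inv p x).imp
      IsIntegralClosure.isIntegral_iff.1 IsIntegralClosure.isIntegral_iff.1
  have hO : ¬ IsField O := by
    have : Algebra.IsIntegral ℤ_[p] O := IsIntegralClosure.isIntegral_algebra ℤ_[p] L
    have := PadicInt.faithfulSMul_of_isScalarTower p L O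
    rw [← Algebra.IsIntegral.isField_iff_isField (R := ℤ_[p]) (FaithfulSMul.algebraMap_injective _ O)]
    exact IsDiscreteValuationRing.not_isField _
  have hiff : IsDiscreteValuationRing O ↔ ValuationRing O :=
    (IsDiscreteValuationRing.TFAE O hO).out 0 1
  exact hiff.2 inferInstance

/-- An extension of rings of integers of finite extensions of `ℚ_[p]` is monogenic. -/
theorem PadicInt.exists_adjoin_singleton_eq_top (p : ℕ) [Fact p.Prime] (L₁ L₂ : Type*)
    [Field L₁] [Algebra ℚ_[p] L₁] [FiniteDimensional ℚ_[p] L₁] [Algebra ℤ_[p] L₁]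
    [IsScalarTower ℤ_[p] ℚ_[p] L₁] [Field L₂] [Algebra ℚ_[p] L₂] [FiniteDimensional ℚ_[p] L₂]
    [Algebra ℤ_[p] L₂] [IsScalarTower ℤ_[p] ℚ_[p] L₂] (O₁ O₂ : Type*)
    [CommRing O₁] [IsDomain O₁] [Algebra ℤ_[p] O₁] [Algebra O₁ L₁] [IsScalarTower ℤ_[p] O₁ L₁]
    [IsIntegralClosure O₁ ℤ_[p] L₁] [CommRing O₂] [IsDomain O₂] [Algebra ℤ_[p] O₂] [Algebra O₂ L₂]
    [IsScalarTower ℤ_[p] O₂ L₂] [IsIntegralClosure O₂ ℤ_[p] L₂]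
    [Algebra O₁ O₂] [FaithfulSMul O₁ O₂] [IsScalarTower ℤ_[p] O₁ O₂] :
    ∃ x : O₂, Algebra.adjoin O₁ {x} = ⊤ ∧ IsIntegral O₁ x := by
  have := PadicInt.isDiscreteValuationRing_of_isIntegralClosure p L₁ O₁
  have := PadicInt.isDiscreteValuationRing_of_isIntegralClosure p L₂ O₂
  have := IsIntegralClosure.finite ℤ_[p] ℚ_[p] L₁ O₁
  have := IsIntegralClosure.finite ℤ_[p] ℚ_[p] L₂ O₂
  have : Module.Finite O₁ O₂ := Module.Finite.of_restrictScalars_finite ℤ_[p] O₁ O₂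
  have := PadicInt.faithfulSMul_of_isScalarTower p L₁ O₁
  have := PadicInt.finite_residueField p O₁
  obtain ⟨x, hx⟩ := IsLocalRing.exists_adjoin_singleton_eq_top_of_isDiscreteValuationRing O₁ O₂ (by
    rw [Ne, Ideal.map_eq_bot_iff_of_injective (FaithfulSMul.algebraMap_injective O₁ O₂)]
    exact IsDiscreteValuationRing.not_a_field O₁)
  exact ⟨x, hx, Algebra.IsIntegral.isIntegral x⟩

theorem minpoly.aeval_derivative_ne_zero {R S : Type*} [CommRing R] [IsDomain R] [CharZero R]
    [IsIntegrallyClosed R] [CommRing S] [IsDomain S] [Algebra R S] [FaithfulSMul R S] {x : S}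
    (hx : IsIntegral R x) : Polynomial.aeval x (minpoly R x).derivative ≠ 0 := by
  intro h
  have h1 := minpoly.isIntegrallyClosed_dvd hx h
  have h2 := Polynomial.derivative_eq_zero.1
    (Polynomial.eq_zero_of_dvd_of_degree_lt h1
      (Polynomial.degree_derivative_lt (minpoly.monic hx).ne_zero))
  exact (minpoly.natDegree_pos hx).ne' h2

/-- Finitely many integers of an algebraic closure of `K` lie in `O_K[x]` for a single integer `x`. -/
theorem PadicInt.exists_mem_adjoin_singleton_of_finset (p : ℕ) [Fact p.Prime]
    (K : Type*) [Field K] [Algebra ℚ_[p] K] [FiniteDimensional ℚ_[p] K]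
    (Kbar : Type*) [Field Kbar] [Algebra K Kbar] [Algebra.IsAlgebraic K Kbar]
    [Algebra ℤ_[p] K] [IsScalarTower ℤ_[p] ℚ_[p] K]
    [Algebra ℚ_[p] Kbar] [Algebra ℤ_[p] Kbar]
    [IsScalarTower ℤ_[p] ℚ_[p] Kbar] [IsScalarTower ℚ_[p] K Kbar]
    (OK : Type*) [CommRing OK] [IsDomain OK] [Algebra ℤ_[p] OK] [Algebra OK K]
    [IsScalarTower ℤ_[p] OK K] [IsIntegralClosure OK ℤ_[p] K]
    (OKbar : Type*) [CommRing OKbar] [IsDomain OKbar] [Algebra ℤ_[p] OKbar] [Algebra OKbar Kbar]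
    [IsScalarTower ℤ_[p] OKbar Kbar] [IsIntegralClosure OKbar ℤ_[p] Kbar]
    [Algebra OK OKbar] [Algebra OK Kbar] [IsScalarTower OK K Kbar]
    [IsScalarTower OK OKbar Kbar] [IsScalarTower ℤ_[p] OK OKbar] [FaithfulSMul OK OKbar]
    (s : Finset OKbar) :
    ∃ x : OKbar, (∀ y ∈ s, y ∈ Algebra.adjoin OK {x}) ∧ IsIntegral OK x := by
  have : IsScalarTower ℤ_[p] K Kbar := .to₁₃₄ ℤ_[p] ℚ_[p] K Kbar
  let L : IntermediateField K Kbar := IntermediateField.adjoin K (algebraMap OKbar Kbar '' s)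
  have : FiniteDimensional K L := IntermediateField.finiteDimensional_adjoin
    fun _ _ ↦ Algebra.IsIntegral.isIntegral _
  have : FiniteDimensional ℚ_[p] L := .trans ℚ_[p] K L
  have : IsScalarTower ℤ_[p] ℚ_[p] L := .of_algebraMap_eq fun x ↦ Subtype.ext <|
    IsScalarTower.algebraMap_apply ℤ_[p] ℚ_[p] Kbar x
  have : IsScalarTower ℤ_[p] L Kbar := .of_algebraMap_eq fun x ↦ rfl
  let O : Subalgebra OK OKbar := (L.toSubalgebra.restrictScalars OK).comap
    (IsScalarTower.toAlgHom OK OKbar Kbar)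
  let φ : O →+* L := ((algebraMap OKbar Kbar).comp O.val.toRingHom).codRestrict L fun x ↦ x.2
  let : Algebra O L := φ.toAlgebra
  have hφ (x : O) : (algebraMap O L x : Kbar) = algebraMap OKbar Kbar x := rfl
  have : IsScalarTower ℤ_[p] O L := .of_algebraMap_eq fun x ↦ Subtype.ext <| by
    rw [hφ]
    exact IsScalarTower.algebraMap_apply ℤ_[p] OKbar Kbar x
  have hint (x : L) : IsIntegral ℤ_[p] (x : Kbar) ↔ IsIntegral ℤ_[p] x :=
    isIntegral_algebraMap_iff (B := Kbar) (algebraMap L Kbar).injective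
  have : IsIntegralClosure O ℤ_[p] L :=
    { algebraMap_injective := fun x y h ↦ Subtype.ext <|
        IsIntegralClosure.algebraMap_injective OKbar ℤ_[p] Kbar congr(($h : Kbar))
      isIntegral_iff := fun {x} ↦ by
        rw [← hint, IsIntegralClosure.isIntegral_iff (A := OKbar)]
        constructor
        · rintro ⟨y, hy⟩
          refine ⟨⟨y, ?_⟩, Subtype.ext hy⟩
          change algebraMap OKbar Kbar y ∈ L
          rw [hy]
          exact x.2
        · rintro ⟨y, rfl⟩
          exact ⟨y, rfl⟩ }
  have : FaithfulSMul OK O := by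
    rw [faithfulSMul_iff_algebraMap_injective]
    exact .of_comp (f := O.val) (FaithfulSMul.algebraMap_injective OK OKbar)
  obtain ⟨x, hx, hx'⟩ := PadicInt.exists_adjoin_singleton_eq_top p K L OK O
  refine ⟨x, fun y hy ↦ ?_, hx'.map O.val⟩
  have hyO : y ∈ O := IntermediateField.subset_adjoin K _ ⟨y, hy, rfl⟩
  have h1 : (⟨y, hyO⟩ : O) ∈ Algebra.adjoin OK {x} := hx ▸ Algebra.mem_top
  have h2 : y ∈ (Algebra.adjoin OK {x}).map O.val := Subalgebra.mem_map.2 ⟨_, h1, rfl⟩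
  rwa [AlgHom.map_adjoin, Set.image_singleton] at h2

/-- Let `K` be a finite extension of `ℚ_p` with ring of integers
`O_K`, `K̄` an algebraic closure with ring of integers `O_K̄`, and `K₀` the maximal
unramified subextension of `K|ℚ_p` with ring of integers `O_{K₀}` (axiomatized by:
`(p)` is maximal in `O_{K₀}`, i.e. `K₀|ℚ_p` is unramified, and the residue extension
of `O_K|O_{K₀}` is trivial, i.e. `K|K₀` is totally ramified).  Then the canonical map
`O_K̄ ⊗_{O_K} Ω¹_{O_K/O_{K₀}} → Ω¹_{O_K̄/O_{K₀}}` is injective with cokernel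
`Ω¹_{O_K̄/O_K}`, and `O_K̄ ⊗_{O_K} Ω¹_{O_K/O_{K₀}} ≅ O_K̄/D_{K/K₀}O_K̄`; hence there
is a short exact sequence
`0 → O_K̄/D_{K/K₀}O_K̄ → Ω¹_{O_K̄/O_{K₀}} → Ω¹_{O_K̄/O_K} → 0`.
Moreover the natural map `Ω¹_{O_K̄/ℤ_p} → Ω¹_{O_K̄/O_{K₀}}` is an isomorphism. -/
theorem kaehler_exact_sequence_over_maximal_unramified_subextension
    (p : ℕ) [Fact p.Prime]
    (K : Type*) [Field K] [Algebra ℚ_[p] K] [FiniteDimensional ℚ_[p] K]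
    (Kbar : Type*) [Field Kbar] [Algebra K Kbar] [IsAlgClosure K Kbar]
    [Algebra ℤ_[p] K] [IsScalarTower ℤ_[p] ℚ_[p] K]
    [Algebra ℚ_[p] Kbar] [Algebra ℤ_[p] Kbar]
    [IsScalarTower ℤ_[p] ℚ_[p] Kbar] [IsScalarTower ℚ_[p] K Kbar]
    (K0 : Type*) [Field K0] [Algebra ℚ_[p] K0] [Algebra K0 K]
    [IsScalarTower ℚ_[p] K0 K]
    [Algebra ℤ_[p] K0] [IsScalarTower ℤ_[p] ℚ_[p] K0]
    (OK0 : Type*) [CommRing OK0] [Algebra ℤ_[p] OK0] [Algebra OK0 K0]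
    [IsScalarTower ℤ_[p] OK0 K0] [IsIntegralClosure OK0 ℤ_[p] K0]
    (OK : Type*) [CommRing OK] [Algebra ℤ_[p] OK] [Algebra OK K]
    [IsScalarTower ℤ_[p] OK K] [IsIntegralClosure OK ℤ_[p] K]
    (OKbar : Type*) [CommRing OKbar] [Algebra ℤ_[p] OKbar] [Algebra OKbar Kbar]
    [IsScalarTower ℤ_[p] OKbar Kbar] [IsIntegralClosure OKbar ℤ_[p] Kbar]
    [Algebra OK0 OK] [Algebra OK0 K] [IsScalarTower OK0 K0 K]
    [IsScalarTower OK0 OK K] [IsScalarTower ℤ_[p] OK0 OK]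
    [Algebra OK OKbar] [Algebra OK Kbar] [IsScalarTower OK K Kbar]
    [IsScalarTower OK OKbar Kbar] [IsScalarTower ℤ_[p] OK OKbar]
    [Algebra OK0 OKbar] [IsScalarTower OK0 OK OKbar] [IsScalarTower ℤ_[p] OK0 OKbar]
    [IsDomain OK0] [IsIntegrallyClosed OK0] [IsDedekindDomain OK] [NoZeroSMulDivisors OK0 OK]
    [IsLocalRing OK]
    -- `K₀|ℚ_p` is unramified:
    (h_unramified : (Ideal.span {(p : OK0)}).IsMaximal)
    -- `K|K₀` is totally ramified (trivial residue extension), so that `K₀` is the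
    -- maximal unramified subextension of `K|ℚ_p`:
    (h_tot_ram : ∀ x : OK, ∃ y : OK0,
      x - algebraMap OK0 OK y ∈ IsLocalRing.maximalIdeal OK) :
    Function.Injective (KaehlerDifferential.mapBaseChange OK0 OK OKbar) ∧
    Function.Exact (KaehlerDifferential.mapBaseChange OK0 OK OKbar)
      (KaehlerDifferential.map OK0 OK OKbar OKbar) ∧
    Function.Surjective (KaehlerDifferential.map OK0 OK OKbar OKbar) ∧
    Nonempty ((OKbar ⊗[OK] KaehlerDifferential OK0 OK) ≃ₗ[OKbar]
      (OKbar ⧸ Ideal.map (algebraMap OK OKbar) (differentIdeal OK0 OK))) ∧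
    Function.Bijective (KaehlerDifferential.map ℤ_[p] OK0 OKbar OKbar) := by
  have : Algebra.IsAlgebraic K Kbar := IsAlgClosure.isAlgebraic
  have : FiniteDimensional ℚ_[p] K0 := .left ℚ_[p] K0 K
  have : FiniteDimensional K0 K := .right ℚ_[p] K0 K
  have : CharZero K0 := charZero_of_injective_algebraMap (algebraMap ℚ_[p] K0).injective
  have : IsScalarTower ℤ_[p] K Kbar := .to₁₃₄ ℤ_[p] ℚ_[p] K Kbar
  have hinj0 := IsIntegralClosure.algebraMap_injective OK0 ℤ_[p] K0
  have hinj := IsIntegralClosure.algebraMap_injective OK ℤ_[p] K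
  have hinjbar := IsIntegralClosure.algebraMap_injective OKbar ℤ_[p] Kbar
  have : IsDomain OKbar := hinjbar.isDomain
  have := PadicInt.faithfulSMul_of_isScalarTower p K0 OK0
  have := PadicInt.faithfulSMul_of_isScalarTower p K OK
  have : CharZero OK0 := charZero_of_injective_algebraMap (FaithfulSMul.algebraMap_injective ℤ_[p] _)
  have : CharZero OK := charZero_of_injective_algebraMap (FaithfulSMul.algebraMap_injective ℤ_[p] _)
  have : FaithfulSMul OK OKbar := by
    rw [faithfulSMul_iff_algebraMap_injective]
    refine .of_comp (f := algebraMap OKbar Kbar) ?_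
    rw [← RingHom.coe_comp, ← IsScalarTower.algebraMap_eq, IsScalarTower.algebraMap_eq OK K Kbar]
    exact (algebraMap K Kbar).injective.comp hinj
  have : FaithfulSMul OK0 OK := by
    rw [faithfulSMul_iff_algebraMap_injective]
    refine .of_comp (f := algebraMap OK K) ?_
    rw [← RingHom.coe_comp, ← IsScalarTower.algebraMap_eq, IsScalarTower.algebraMap_eq OK0 K0 K]
    exact (algebraMap K0 K).injective.comp hinj0
  have := PadicInt.isDiscreteValuationRing_of_isIntegralClosure p K0 OK0
  have := PadicInt.isDiscreteValuationRing_of_isIntegralClosure p K OK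
  have := IsIntegralClosure.isFractionRing_of_finite_extension ℤ_[p] ℚ_[p] K0 OK0
  have := IsIntegralClosure.isFractionRing_of_finite_extension ℤ_[p] ℚ_[p] K OK
  have := IsIntegralClosure.finite ℤ_[p] ℚ_[p] K0 OK0
  refine ⟨?_, KaehlerDifferential.exact_mapBaseChange_map OK0 OK OKbar,
    KaehlerDifferential.map_surjective OK0 OK OKbar, ?_, ?_⟩
  · have : Subsingleton (Algebra.H1Cotangent OK OKbar) := by
      refine Algebra.Generators.subsingleton_h1Cotangent_of_adjoin_singleton _ fun s ↦ ?_
      obtain ⟨x, hx, hx'⟩ := PadicInt.exists_mem_adjoin_singleton_of_finset p K Kbar OK OKbar s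
      exact ⟨x, minpoly OK x, hx, minpoly.aeval _ _, minpoly.aeval_derivative_ne_zero hx',
        fun q hq ↦ minpoly.isIntegrallyClosed_dvd hx' hq⟩
    rw [injective_iff_map_eq_zero]
    intro x hx
    obtain ⟨x, rfl⟩ := (Algebra.H1Cotangent.exact_δ_mapBaseChange OK0 OK OKbar x).mp hx
    rw [Subsingleton.elim x 0, map_zero]
  · obtain ⟨x, hx, hx'⟩ := PadicInt.exists_adjoin_singleton_eq_top p K0 K OK0 OK
    obtain ⟨e⟩ := KaehlerDifferential.nonempty_equiv_quotient_of_adjoin_eq_top hx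
      (minpoly.aeval OK0 x) fun q hq ↦ minpoly.isIntegrallyClosed_dvd hx' hq
    have : IsScalarTower ℤ_[p] OK0 K := .to₁₂₄ ℤ_[p] OK0 OK K
    have : IsIntegralClosure OK OK0 K := .tower_top (R := ℤ_[p])
    have hxK : Algebra.adjoin K0 {algebraMap OK K x} = ⊤ := by
      have hmem (b : OK) : algebraMap OK K b ∈ Algebra.adjoin K0 {algebraMap OK K x} := by
        have h : b ∈ Algebra.adjoin OK0 {x} := hx ▸ Algebra.mem_top
        rw [Algebra.adjoin_singleton_eq_range_aeval] at h ⊢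
        obtain ⟨q, rfl⟩ := h
        exact ⟨q.map (algebraMap OK0 K0), by simp [Polynomial.aeval_algebraMap_apply]⟩
      refine eq_top_iff.2 fun y _ ↦ ?_
      obtain ⟨a, b, -, rfl⟩ := IsFractionRing.div_surjective OK y
      rw [div_eq_mul_inv]
      exact mul_mem (hmem a) (Subalgebra.inv_mem_of_algebraic _ (x := ⟨_, hmem b⟩)
        (Algebra.IsAlgebraic.isAlgebraic _))
    have hdiff := conductor_mul_differentIdeal OK0 K0 K x hxK
    rw [conductor_eq_top_of_adjoin_eq_top hx, ← Ideal.one_eq_top, one_mul] at hdiff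
    rw [hdiff]
    exact ⟨TensorProduct.AlgebraTensorModule.congr (.refl OKbar OKbar) e ≪≫ₗ
      (Algebra.TensorProduct.quotIdealMapEquivTensorQuot OKbar (Ideal.span
        {Polynomial.aeval x (minpoly OK0 x).derivative})).symm.toLinearEquiv⟩
  · have : Finite (IsLocalRing.ResidueField ℤ_[p]) := PadicInt.finite_residueField p ℤ_[p]
    have : Algebra.FormallyUnramified ℤ_[p] OK0 := by
      refine Algebra.FormallyUnramified.of_map_maximalIdeal ?_
      rw [PadicInt.maximalIdeal_eq_span_p, Ideal.map_span, Set.image_singleton, map_natCast]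
      exact IsLocalRing.eq_maximalIdeal h_unramified
    refine ⟨?_, KaehlerDifferential.map_surjective _ _ _⟩
    rw [injective_iff_map_eq_zero]
    intro x hx
    obtain ⟨x, rfl⟩ := (KaehlerDifferential.exact_mapBaseChange_map ℤ_[p] OK0 OKbar x).mp hx
    rw [Subsingleton.elim x 0, map_zero]
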